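/- Let A₁, …, A_{n-2}, A be positive semidefinite n×n Hermitian matrices with D(A₁,…,A_{n-2},A,·) ≠ 0 as a functional on Hermitian matrices. Then for any Hermitian B with D(A₁,…,A_{n-2},A,B) = 0, one has D(A₁,…,A_{n-2},B,B) ≤ 0. -/

import Mathlib

open scoped ComplexOrder

/-- The mixed discriminant of `m` Hermitian `m × m` complex matrices: the full
polarization of the determinant, `D(A, …, A) = det A`. -/
noncomputable def mixedDisc {m : ℕ} (A : Fin m → Matrix (Fin m) (Fin m) ℂ) : ℝ :=
  ((m.factorial : ℂ)⁻¹ *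
    ∑ σ : Equiv.Perm (Fin m), (Matrix.of fun i j => A (σ j) i j).det).re

/-- `D(A₁, …, Aₙ, X, Y)` for a family of `n` matrices of size `n + 2` together
with two extra entries `X`, `Y`. -/
noncomputable def mixedDisc2 {n : ℕ} (A : Fin n → Matrix (Fin (n + 2)) (Fin (n + 2)) ℂ)
    (X Y : Matrix (Fin (n + 2)) (Fin (n + 2)) ℂ) : ℝ :=
  mixedDisc (Fin.snoc (Fin.snoc A X) Y)

/-- If all roots lie in the open lower half plane, the linear coefficient is nonzero. -/
lemma coeff_one_ne_zero_of_roots (P : Polynomial ℂ) (hd : 0 < P.natDegree)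
    (h : ∀ t : ℂ, 0 ≤ t.im → P.eval t ≠ 0) : P.coeff 1 ≠ 0 := by
  intro h1
  have hdeg : 0 < P.degree := Polynomial.natDegree_pos_iff_degree_pos.1 hd
  have hder : P.derivative ≠ 0 := by
    intro h0
    have := Polynomial.derivative_eq_zero.1 h0
    omega
  have h0 : (0 : ℂ) ∈ P.derivative.rootSet ℂ := by
    rw [Polynomial.mem_rootSet]
    refine ⟨hder, ?_⟩
    rw [Polynomial.coe_aeval_eq_eval, ← Polynomial.coeff_zero_eq_eval_zero,
      Polynomial.coeff_derivative]
    simp [h1]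
  have h2 := Polynomial.rootSet_derivative_subset_convexHull_rootSet hdeg h0
  have h3 : convexHull ℝ (P.rootSet ℂ) ⊆ {z : ℂ | z.im < 0} := by
    apply convexHull_min
    · intro z hz
      by_contra hc
      have hz2 := (Polynomial.mem_rootSet.1 hz).2
      rw [Polynomial.coe_aeval_eq_eval] at hz2
      exact h z (not_lt.1 hc) hz2
    · exact convex_halfSpace_im_lt 0
  have := h3 h2
  simp at this

lemma stable_piecewise {ι V : Type*} [Fintype ι] [DecidableEq ι] [AddCommGroup V] [Module ℂ V]
    (M : MultilinearMap ℂ (fun _ : ι => V) ℂ)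
    (hsymm : ∀ (σ : Equiv.Perm ι) (a : ι → V), M (fun i => a (σ i)) = M a)
    (P U : Set V)
    (hU : ∀ z ∈ U, ∀ a ∈ P, ∀ t : ℂ, 0 ≤ t.im → z + t • a ∈ U)
    (hI : ∀ a ∈ P, Complex.I • a ∈ U)
    (hM : ∀ z ∈ U, M (fun _ => z) ≠ 0)
    (a : ι → V) (ha : ∀ i, a i ∈ P) (S : Finset ι) :
    ∀ z ∈ U, M (S.piecewise a (fun _ => z)) ≠ 0 := by
  induction S using Finset.induction_on with
  | empty => intro z hz; simpa using hM z hz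
  | insert j S hj ih =>
    intro z hz
    set m : ι → V := S.piecewise a (fun _ => z) with hm
    set m' : ι → V := S.piecewise (fun _ => 0) (fun _ => a j) with hm'
    let c : Finset ι → ℂ := fun s => M (s.piecewise m' m)
    let Q : Polynomial ℂ := ∑ s : Finset ι, Polynomial.C (c s) * Polynomial.X ^ s.card
    have hQ : ∀ t : ℂ, Q.eval t = M (S.piecewise a (fun _ => z + t • a j)) := by
      intro t
      have e1 : S.piecewise a (fun _ => z + t • a j) = (fun i => t • m' i) + m := by
        ext i
        by_cases hi : i ∈ S <;> simp [hm, hm', hi, add_comm]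
      rw [e1, MultilinearMap.map_add_univ]
      simp only [Q, Polynomial.eval_finsetSum, Polynomial.eval_mul, Polynomial.eval_C,
        Polynomial.eval_pow, Polynomial.eval_X]
      refine Finset.sum_congr rfl fun s _ => ?_
      have e2 : s.piecewise (fun i => t • m' i) m
          = s.piecewise (fun i => (fun _ => t) i • (s.piecewise m' m) i) (s.piecewise m' m) := by
        ext i
        by_cases hi : i ∈ s <;> simp [hi]
      rw [e2, MultilinearMap.map_piecewise_smul]
      simp [c, mul_comm]
    have hc0 : ∀ s : Finset ι, (∃ i ∈ s, i ∈ S) → c s = 0 := by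
      rintro s ⟨i, hi, hiS⟩
      apply M.map_coord_zero i
      simp [hi, hm', hiS]
    have hcoeff : ∀ k, Q.coeff k = ∑ s : Finset ι, if s.card = k then c s else 0 := by
      intro k
      simp only [Q, Polynomial.finsetSum_coeff, Polynomial.coeff_C_mul, Polynomial.coeff_X_pow]
      refine Finset.sum_congr rfl fun s _ => ?_
      by_cases h : s.card = k
      · simp [h]
      · simp [h, Ne.symm h]
    have htop : Q.coeff (Sᶜ).card ≠ 0 := by
      rw [hcoeff, Finset.sum_eq_single Sᶜ]
      · simp only [if_true, c]
        have e3 : (Sᶜ).piecewise m' m = S.piecewise a (fun _ => a j) := by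
          ext i
          by_cases hi : i ∈ S <;> simp [hm, hm', hi]
        rw [e3]
        have h4 := ih _ (hI _ (ha j))
        intro h5
        apply h4
        have e4 : S.piecewise a (fun _ => Complex.I • a j)
            = (Sᶜ).piecewise (fun i => (fun _ => Complex.I) i • (S.piecewise a (fun _ => a j)) i)
              (S.piecewise a (fun _ => a j)) := by
          ext i
          by_cases hi : i ∈ S <;> simp [hi]
        rw [e4, MultilinearMap.map_piecewise_smul, h5, smul_zero]
      · intro s _ hs
        split_ifs with hcard
        · apply hc0
          by_contra hcon
          push Not at hcon
          apply hs
          apply Finset.eq_of_subset_of_card_le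
          · intro i hi
            simpa using hcon i hi
          · omega
        · rfl
      · simp
    have hpos : 0 < (Sᶜ).card := Finset.card_pos.2 ⟨j, by simpa using hj⟩
    have hdeg : 0 < Q.natDegree := lt_of_lt_of_le hpos (Polynomial.le_natDegree_of_ne_zero htop)
    have h1 := coeff_one_ne_zero_of_roots Q hdeg (fun t ht => by
      rw [hQ]
      exact ih _ (hU z hz _ (ha j) t ht))
    intro hzero
    apply h1
    rw [hcoeff]
    refine Finset.sum_eq_zero fun s _ => ?_
    split_ifs with hs
    · obtain ⟨i, rfl⟩ := Finset.card_eq_one.1 hs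
      by_cases hi : i ∈ S
      · exact hc0 _ ⟨i, by simp, hi⟩
      · rw [← hzero, ← hsymm (Equiv.swap i j)]
        simp only [c]
        congr 1
        ext k
        rw [Finset.piecewise_insert, Finset.piecewise_singleton]
        by_cases hki : k = i
        · subst hki
          simp [hm', hi]
        · by_cases hkj : k = j
          · subst hkj
            rw [Equiv.swap_apply_right, Function.update_of_ne hki, Function.update_of_ne (Ne.symm hki)]
            simp [hm, hi, hj]
          · rw [Equiv.swap_apply_of_ne_of_ne hki hkj, Function.update_of_ne hki,
              Function.update_of_ne hkj]
    · rfl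

/-- The `j`-th column of a matrix, as a linear map. -/
def colMap (m : ℕ) (j : Fin m) : Matrix (Fin m) (Fin m) ℂ →ₗ[ℂ] (Fin m → ℂ) where
  toFun X := fun i => X i j
  map_add' _ _ := rfl
  map_smul' _ _ := rfl

/-- Complex valued mixed discriminant as a multilinear map. -/
noncomputable def mixedM (m : ℕ) :
    MultilinearMap ℂ (fun _ : Fin m => Matrix (Fin m) (Fin m) ℂ) ℂ :=
  (m.factorial : ℂ)⁻¹ • ∑ σ : Equiv.Perm (Fin m),
    ((Matrix.detRowAlternating (n := Fin m) (R := ℂ)).toMultilinearMap.compLinearMap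
      (fun j => colMap m j)).domDomCongr σ

lemma mixedM_apply {m : ℕ} (A : Fin m → Matrix (Fin m) (Fin m) ℂ) :
    mixedM m A = (m.factorial : ℂ)⁻¹ *
      ∑ σ : Equiv.Perm (Fin m), (Matrix.of fun i j => A (σ j) i j).det := by
  simp only [mixedM, MultilinearMap.smul_apply, MultilinearMap.sum_apply, smul_eq_mul]
  congr 1
  refine Finset.sum_congr rfl fun σ _ => ?_
  rw [← Matrix.det_transpose]
  rfl

lemma mixedDisc_eq {m : ℕ} (A : Fin m → Matrix (Fin m) (Fin m) ℂ) :
    mixedDisc A = (mixedM m A).re := by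
  rw [mixedM_apply]; rfl

lemma mixedM_symm {m : ℕ} (τ : Equiv.Perm (Fin m)) (A : Fin m → Matrix (Fin m) (Fin m) ℂ) :
    mixedM m (fun i => A (τ i)) = mixedM m A := by
  rw [mixedM_apply, mixedM_apply]
  congr 1
  exact Equiv.sum_comp (Equiv.mulLeft τ) (fun σ => (Matrix.of fun i j => A (σ j) i j).det)

lemma mixedM_const {m : ℕ} (Z : Matrix (Fin m) (Fin m) ℂ) :
    mixedM m (fun _ => Z) = Z.det := by
  rw [mixedM_apply]
  have : (Matrix.of fun i j => Z i j) = Z := rfl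
  rw [this]
  simp only [Finset.sum_const, Finset.card_univ, Fintype.card_perm, Fintype.card_fin, nsmul_eq_mul]
  rw [← mul_assoc, inv_mul_cancel₀ (by exact_mod_cast m.factorial_ne_zero), one_mul]

lemma mixedM_im {m : ℕ} (A : Fin m → Matrix (Fin m) (Fin m) ℂ) (hA : ∀ i, (A i).IsHermitian) :
    (mixedM m A).im = 0 := by
  rw [← Complex.conj_eq_iff_im, mixedM_apply, map_mul, map_inv₀, map_natCast]
  congr 1
  simp only [Matrix.det_apply', map_sum, map_mul, map_prod, Matrix.of_apply, map_intCast]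
  rw [Finset.sum_comm]
  conv_rhs => rw [Finset.sum_comm]
  rw [← Equiv.sum_comp (Equiv.inv (Equiv.Perm (Fin m)))]
  refine Finset.sum_congr rfl fun π _ => ?_
  rw [← Equiv.sum_comp (Equiv.mulRight π⁻¹)]
  refine Finset.sum_congr rfl fun σ _ => ?_
  simp only [Equiv.inv_apply, Equiv.Perm.sign_inv, Equiv.coe_mulRight, Equiv.Perm.mul_apply]
  congr 1
  rw [← Equiv.prod_comp π]
  refine Finset.prod_congr rfl fun i _ => ?_
  rw [show π⁻¹ (π i) = i from π.symm_apply_apply i]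
  exact (hA (σ i)).apply _ _

def upperSet (m : ℕ) : Set (Matrix (Fin m) (Fin m) ℂ) :=
  {Z | ∃ X Y : Matrix (Fin m) (Fin m) ℂ, X.IsHermitian ∧ Y.PosDef ∧ Z = X + Complex.I • Y}

lemma herm_real_smul {m : ℕ} {X : Matrix (Fin m) (Fin m) ℂ} (hX : X.IsHermitian) (r : ℝ) :
    ((r : ℂ) • X).IsHermitian := by
  unfold Matrix.IsHermitian
  rw [Matrix.conjTranspose_smul, hX.eq]
  simp

lemma upper_add {m : ℕ} (Z : Matrix (Fin m) (Fin m) ℂ) (hZ : Z ∈ upperSet m)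
    (A : Matrix (Fin m) (Fin m) ℂ) (hA : A.PosDef) (t : ℂ) (ht : 0 ≤ t.im) :
    Z + t • A ∈ upperSet m := by
  obtain ⟨X, Y, hX, hY, rfl⟩ := hZ
  refine ⟨X + (t.re : ℂ) • A, Y + (t.im : ℂ) • A, hX.add (herm_real_smul hA.isHermitian _),
    hY.add_posSemidef (hA.posSemidef.smul (by exact_mod_cast ht)), ?_⟩
  conv_lhs => rw [← Complex.re_add_im t]
  module

lemma upper_herm_add {m : ℕ} {B A : Matrix (Fin m) (Fin m) ℂ} (hB : B.IsHermitian)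
    (hA : A.PosDef) (t : ℂ) (ht : 0 < t.im) : B + t • A ∈ upperSet m := by
  refine ⟨B + (t.re : ℂ) • A, (t.im : ℂ) • A, hB.add (herm_real_smul hA.isHermitian _),
    hA.smul (by exact_mod_cast ht), ?_⟩
  conv_lhs => rw [← Complex.re_add_im t]
  module

lemma upper_det {m : ℕ} (Z : Matrix (Fin m) (Fin m) ℂ) (hZ : Z ∈ upperSet m) : Z.det ≠ 0 := by
  obtain ⟨X, Y, hX, hY, rfl⟩ := hZ
  intro h
  obtain ⟨v, hv, hv0⟩ := Matrix.exists_mulVec_eq_zero_iff.2 h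
  have h1 : star v ⬝ᵥ (X + Complex.I • Y).mulVec v = 0 := by rw [hv0]; simp
  rw [Matrix.add_mulVec, dotProduct_add, Matrix.smul_mulVec, dotProduct_smul] at h1
  have hx := hX.im_star_dotProduct_mulVec_self v
  have hy := hY.re_dotProduct_pos hv
  have h2 := congrArg Complex.im h1
  simp at h2 hx hy
  linarith

lemma mixedM_piecewise {m : ℕ} (A : Fin m → Matrix (Fin m) (Fin m) ℂ) (hA : ∀ i, (A i).PosDef)
    (S : Finset (Fin m)) (Z : Matrix (Fin m) (Fin m) ℂ) (hZ : Z ∈ upperSet m) :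
    mixedM m (S.piecewise A (fun _ => Z)) ≠ 0 :=
  stable_piecewise (mixedM m) mixedM_symm {A | A.PosDef} (upperSet m)
    (fun z hz a ha t ht => upper_add z hz a ha t ht)
    (fun a ha => by
      simpa using upper_herm_add (B := 0) Matrix.isHermitian_zero ha Complex.I (by simp))
    (fun z hz => by rw [mixedM_const]; exact upper_det z hz) A hA S Z hZ

lemma mixedDisc_ne_zero {m : ℕ} (A : Fin m → Matrix (Fin m) (Fin m) ℂ) (hA : ∀ i, (A i).PosDef) :
    mixedDisc A ≠ 0 := by
  have h := mixedM_piecewise A hA Finset.univ (0 + Complex.I • 1)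
    (upper_herm_add Matrix.isHermitian_zero Matrix.PosDef.one _ (by simp))
  rw [Finset.piecewise_univ] at h
  rw [mixedDisc_eq]
  intro h0
  exact h (Complex.ext h0 (mixedM_im A fun i => (hA i).isHermitian))

lemma continuous_mixedDisc {m : ℕ} : Continuous
    (mixedDisc : (Fin m → Matrix (Fin m) (Fin m) ℂ) → ℝ) := by
  unfold mixedDisc
  refine Complex.continuous_re.comp (continuous_const.mul (continuous_finsetSum _ fun σ _ => ?_))
  apply Continuous.matrix_det
  refine continuous_matrix fun i j => ?_
  simp only [Matrix.of_apply]
  exact (continuous_apply_apply i j).comp (continuous_apply (σ j))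

lemma mixedDisc_nonneg {m : ℕ} (A : Fin m → Matrix (Fin m) (Fin m) ℂ)
    (hA : ∀ i, (A i).PosSemidef) : 0 ≤ mixedDisc A := by
  by_contra hneg
  push Not at hneg
  let g : ℝ → ℝ := fun t => mixedDisc (fun i => ((1 - t : ℝ) : ℂ) • 1 + (t : ℂ) • A i)
  have hg : Continuous g := by
    refine continuous_mixedDisc.comp (continuous_pi fun i => ?_)
    fun_prop
  have g0 : g 0 = 1 := by
    simp only [g]
    rw [mixedDisc_eq]
    simp [mixedM_const]
  have g1 : g 1 = mixedDisc A := by simp [g]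
  have hmem : (0 : ℝ) ∈ Set.Icc (g 1) (g 0) := by
    rw [g0, g1]; exact ⟨hneg.le, zero_le_one⟩
  obtain ⟨t, ht, h0⟩ := intermediate_value_Icc' zero_le_one hg.continuousOn hmem
  have ht1 : t < 1 := by
    rcases ht.2.lt_or_eq with h | h
    · exact h
    · rw [h, g1] at h0; exact absurd h0 hneg.ne
  refine mixedDisc_ne_zero _ (fun i => ?_) h0
  refine Matrix.PosDef.add_posSemidef (Matrix.PosDef.one.smul ?_) ((hA i).smul ?_)
  · have : 0 < 1 - t := by linarith
    exact_mod_cast this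
  · exact_mod_cast ht.1

section two
variable {n : ℕ} (A : Fin n → Matrix (Fin (n + 2)) (Fin (n + 2)) ℂ)

noncomputable def mixedM2 (X Y : Matrix (Fin (n + 2)) (Fin (n + 2)) ℂ) : ℂ :=
  mixedM (n + 2) (Fin.snoc (Fin.snoc A X) Y)

lemma mixedDisc2_eq (X Y : Matrix (Fin (n + 2)) (Fin (n + 2)) ℂ) :
    mixedDisc2 A X Y = (mixedM2 A X Y).re := mixedDisc_eq _

lemma mixedM2_add_right (X Y Z : Matrix (Fin (n + 2)) (Fin (n + 2)) ℂ) :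
    mixedM2 A X (Y + Z) = mixedM2 A X Y + mixedM2 A X Z :=
  MultilinearMap.snoc_add (mixedM (n + 2)) (Fin.snoc A X) Y Z

lemma mixedM2_smul_right (X Y : Matrix (Fin (n + 2)) (Fin (n + 2)) ℂ) (c : ℂ) :
    mixedM2 A X (c • Y) = c * mixedM2 A X Y :=
  MultilinearMap.snoc_smul (mixedM (n + 2)) (Fin.snoc A X) c Y

lemma mixedM2_symm (X Y : Matrix (Fin (n + 2)) (Fin (n + 2)) ℂ) :
    mixedM2 A X Y = mixedM2 A Y X := by
  unfold mixedM2
  rw [← mixedM_symm (Equiv.swap (Fin.last (n + 1)) (Fin.last n).castSucc)]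
  congr 1
  funext i
  refine Fin.lastCases ?_ (fun i => Fin.lastCases ?_ (fun i => ?_) i) i
  · rw [Equiv.swap_apply_left]; simp
  · rw [Equiv.swap_apply_right]; simp
  · rw [Equiv.swap_apply_of_ne_of_ne (Fin.castSucc_lt_last _).ne]
    · simp
    · exact fun h => (Fin.castSucc_lt_last i).ne (Fin.castSucc_injective _ h)

lemma mixedM2_add_left (X Y Z : Matrix (Fin (n + 2)) (Fin (n + 2)) ℂ) :
    mixedM2 A (Y + Z) X = mixedM2 A Y X + mixedM2 A Z X := by
  rw [mixedM2_symm, mixedM2_add_right, mixedM2_symm A X Y, mixedM2_symm A X Z]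

lemma mixedM2_smul_left (X Y : Matrix (Fin (n + 2)) (Fin (n + 2)) ℂ) (c : ℂ) :
    mixedM2 A (c • Y) X = c * mixedM2 A Y X := by
  rw [mixedM2_symm, mixedM2_smul_right, mixedM2_symm]

variable {A}

lemma snoc2_forall {p : Matrix (Fin (n + 2)) (Fin (n + 2)) ℂ → Prop} (hA : ∀ i, p (A i))
    {X Y : Matrix (Fin (n + 2)) (Fin (n + 2)) ℂ} (hX : p X) (hY : p Y) (i : Fin (n + 2)) :
    p ((Fin.snoc (Fin.snoc A X : Fin (n + 1) → Matrix (Fin (n + 2)) (Fin (n + 2)) ℂ) Y :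
      Fin (n + 2) → Matrix (Fin (n + 2)) (Fin (n + 2)) ℂ) i) := by
  refine Fin.lastCases ?_ (fun i => Fin.lastCases ?_ (fun i => ?_) i) i
  · simpa using hY
  · simpa using hX
  · simpa using hA i

lemma mixedM2_real (hA : ∀ i, (A i).IsHermitian) {X Y : Matrix (Fin (n + 2)) (Fin (n + 2)) ℂ}
    (hX : X.IsHermitian) (hY : Y.IsHermitian) :
    mixedM2 A X Y = (mixedDisc2 A X Y : ℂ) := by
  apply Complex.ext
  · rw [mixedDisc2_eq]; simp
  · rw [Complex.ofReal_im]
    exact mixedM_im _ (snoc2_forall (p := Matrix.IsHermitian) hA hX hY)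

lemma mixedM2_ne_zero (hA : ∀ i, (A i).PosDef) (Z : Matrix (Fin (n + 2)) (Fin (n + 2)) ℂ)
    (hZ : Z ∈ upperSet (n + 2)) : mixedM2 A Z Z ≠ 0 := by
  have h := mixedM_piecewise (Fin.snoc (Fin.snoc A 1) 1)
    (snoc2_forall (p := Matrix.PosDef) hA Matrix.PosDef.one Matrix.PosDef.one)
    (Finset.univ.filter fun i => i.1 < n) Z hZ
  convert h using 2
  unfold mixedM2
  congr 1
  funext i
  refine Fin.lastCases ?_ (fun i => Fin.lastCases ?_ (fun i => ?_) i) i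
  · simp [Finset.piecewise]
  · simp [Finset.piecewise]
  · simp [Finset.piecewise]

lemma mixedDisc2_nonneg (hA : ∀ i, (A i).PosSemidef)
    {X Y : Matrix (Fin (n + 2)) (Fin (n + 2)) ℂ} (hX : X.PosSemidef) (hY : Y.PosSemidef) :
    0 ≤ mixedDisc2 A X Y :=
  mixedDisc_nonneg _ (snoc2_forall (p := Matrix.PosSemidef) hA hX hY)

/-- Alexandrov's inequality, positive definite case. -/
lemma alexandrov_posDef (hA : ∀ i, (A i).PosDef)
    {X B : Matrix (Fin (n + 2)) (Fin (n + 2)) ℂ} (hX : X.PosDef) (hB : B.IsHermitian) :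
    mixedDisc2 A X X * mixedDisc2 A B B ≤ mixedDisc2 A X B ^ 2 := by
  by_contra hlt
  push Not at hlt
  have hH : ∀ i, (A i).IsHermitian := fun i => (hA i).isHermitian
  have hXX := mixedM2_real hH hX.isHermitian hX.isHermitian
  have hXB := mixedM2_real hH hX.isHermitian hB
  have hBB := mixedM2_real hH hB hB
  have ha := mixedDisc2_nonneg (fun i => (hA i).posSemidef) hX.posSemidef hX.posSemidef
  set a := mixedDisc2 A X X
  set b := mixedDisc2 A X B
  set c := mixedDisc2 A B B
  have ha' : 0 < a := by
    rcases ha.lt_or_eq with h | h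
    · exact h
    · rw [← h] at hlt; nlinarith [sq_nonneg b]
  have hd : 0 < a * c - b ^ 2 := by linarith
  set s := Real.sqrt (a * c - b ^ 2)
  have hs : 0 < s := Real.sqrt_pos.2 hd
  have hs2 : s ^ 2 = a * c - b ^ 2 := Real.sq_sqrt hd.le
  let t : ℂ := ⟨-b / a, s / a⟩
  have ht : (a : ℂ) * t = -b + s * Complex.I := by
    apply Complex.ext <;> simp [t] <;> field_simp
  have hne := mixedM2_ne_zero hA _ (upper_herm_add hB hX t (div_pos hs ha'))
  apply hne
  rw [mixedM2_add_right, mixedM2_add_left, mixedM2_add_left, mixedM2_smul_right,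
    mixedM2_smul_right, mixedM2_smul_left, mixedM2_smul_left, mixedM2_symm A B X, hXX, hXB, hBB]
  have haC : (a : ℂ) ≠ 0 := by exact_mod_cast ha'.ne'
  have hs2C : (s : ℂ) ^ 2 = a * c - b ^ 2 := by exact_mod_cast hs2
  apply mul_left_cancel₀ haC
  linear_combination (a * t + (-b + s * Complex.I) + 2 * b) * ht + s ^ 2 * Complex.I_sq - hs2C


lemma continuous_mixedDisc2 {A : ℝ → Fin n → Matrix (Fin (n + 2)) (Fin (n + 2)) ℂ}
    {X Y : ℝ → Matrix (Fin (n + 2)) (Fin (n + 2)) ℂ} (hA : Continuous A) (hX : Continuous X)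
    (hY : Continuous Y) : Continuous (fun e => mixedDisc2 (A e) (X e) (Y e)) := by
  unfold mixedDisc2
  refine continuous_mixedDisc.comp (continuous_pi fun i => ?_)
  refine Fin.lastCases ?_ (fun i => Fin.lastCases ?_ (fun i => ?_) i) i
  · simpa using hY
  · simpa using hX
  · have h : Continuous fun e => A e i := (continuous_apply i).comp hA
    simpa using h

/-- Alexandrov's inequality. -/
lemma alexandrov (hA : ∀ i, (A i).PosSemidef)
    {X B : Matrix (Fin (n + 2)) (Fin (n + 2)) ℂ} (hX : X.PosSemidef) (hB : B.IsHermitian) :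
    mixedDisc2 A X X * mixedDisc2 A B B ≤ mixedDisc2 A X B ^ 2 := by
  let A' : ℝ → Fin n → Matrix (Fin (n + 2)) (Fin (n + 2)) ℂ := fun e i => (e : ℂ) • 1 + A i
  let X' : ℝ → Matrix (Fin (n + 2)) (Fin (n + 2)) ℂ := fun e => (e : ℂ) • 1 + X
  have cA : Continuous A' := by
    refine continuous_pi fun i => ?_
    fun_prop
  have cX : Continuous X' := by fun_prop
  have cl : Continuous fun e => mixedDisc2 (A' e) (X' e) (X' e) * mixedDisc2 (A' e) B B :=
    (continuous_mixedDisc2 cA cX cX).mul (continuous_mixedDisc2 cA continuous_const continuous_const)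
  have cr : Continuous fun e => mixedDisc2 (A' e) (X' e) B ^ 2 :=
    (continuous_mixedDisc2 cA cX continuous_const).pow 2
  have hA0 : A' 0 = A := by ext i; simp [A']
  have hX0 : X' 0 = X := by simp [X']
  have tl := (cl.tendsto 0).mono_left (nhdsWithin_le_nhds (s := Set.Ioi 0))
  have tr := (cr.tendsto 0).mono_left (nhdsWithin_le_nhds (s := Set.Ioi 0))
  rw [hA0, hX0] at tl tr
  refine le_of_tendsto_of_tendsto tl tr ?_
  filter_upwards [self_mem_nhdsWithin] with e he
  have he' : (0 : ℂ) < (e : ℂ) := by exact_mod_cast (show (0 : ℝ) < e from he)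
  exact alexandrov_posDef (fun i => (Matrix.PosDef.one.smul he').add_posSemidef (hA i))
    ((Matrix.PosDef.one.smul he').add_posSemidef hX) hB

end two

theorem stmt10 {n : ℕ} (A : Fin n → Matrix (Fin (n + 2)) (Fin (n + 2)) ℂ)
    (hA : ∀ i, (A i).PosSemidef)
    (A' : Matrix (Fin (n + 2)) (Fin (n + 2)) ℂ) (hA' : A'.PosSemidef)
    (hne : ∃ C : Matrix (Fin (n + 2)) (Fin (n + 2)) ℂ, C.IsHermitian ∧
      mixedDisc2 A A' C ≠ 0)
    (B : Matrix (Fin (n + 2)) (Fin (n + 2)) ℂ) (hB : B.IsHermitian)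
    (hAB : mixedDisc2 A A' B = 0) :
    mixedDisc2 A B B ≤ 0 := by
  obtain ⟨C, hC, hC0⟩ := hne
  -- a positive semidefinite direction on which the functional is positive
  obtain ⟨P, hP, hP0⟩ : ∃ P : Matrix (Fin (n + 2)) (Fin (n + 2)) ℂ, P.PosSemidef ∧
      0 < mixedDisc2 A A' P := by
    have hsq : ∀ E : Matrix (Fin (n + 2)) (Fin (n + 2)) ℂ, E.IsHermitian → (E * E).PosSemidef := by
      intro E hE
      have := Matrix.posSemidef_conjTranspose_mul_self E
      rwa [hE.eq] at this
    have h1 := hsq (C + 1) (hC.add Matrix.isHermitian_one)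
    have h2 := hsq (C - 1) (hC.sub Matrix.isHermitian_one)
    have e : (C + 1) * (C + 1) = (C - 1) * (C - 1) + (4 : ℂ) • C := by
      have : (4 : ℂ) • C = C + C + C + C := by module
      rw [this]
      noncomm_ring
    by_contra hcon
    push Not at hcon
    have z1 := le_antisymm (hcon _ h1) (mixedDisc2_nonneg hA hA' h1)
    have z2 := le_antisymm (hcon _ h2) (mixedDisc2_nonneg hA hA' h2)
    apply hC0
    rw [e, mixedDisc2_eq, mixedM2_add_right, mixedM2_smul_right, Complex.add_re,
      ← mixedDisc2_eq, z2] at z1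
    rw [mixedDisc2_eq]
    simpa using z1
  by_contra hpos
  push Not at hpos
  have key : ∀ e : ℝ, 0 < e → (2 * mixedDisc2 A A' P) * mixedDisc2 A B B
      ≤ e * mixedDisc2 A P B ^ 2 := by
    intro e he
    have heC : (0 : ℂ) ≤ (e : ℂ) := by exact_mod_cast he.le
    have h := alexandrov hA (hA'.add (hP.smul heC)) hB
    have e1 : mixedDisc2 A (A' + (e : ℂ) • P) (A' + (e : ℂ) • P)
        = mixedDisc2 A A' A' + 2 * e * mixedDisc2 A A' P + e ^ 2 * mixedDisc2 A P P := by
      simp only [mixedDisc2_eq]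
      rw [mixedM2_add_right, mixedM2_add_left, mixedM2_add_left, mixedM2_smul_right,
        mixedM2_smul_right, mixedM2_smul_left, mixedM2_smul_left, mixedM2_symm A P A']
      simp only [Complex.add_re, Complex.re_ofReal_mul]
      ring
    have e2 : mixedDisc2 A (A' + (e : ℂ) • P) B = e * mixedDisc2 A P B := by
      rw [mixedDisc2_eq, mixedM2_add_left, mixedM2_smul_left, Complex.add_re,
        Complex.re_ofReal_mul, ← mixedDisc2_eq, ← mixedDisc2_eq, hAB, zero_add]
    rw [e1, e2] at h
    have n1 := mul_nonneg (mixedDisc2_nonneg hA hA' hA') hpos.le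
    have n2 := mul_nonneg (mul_nonneg (sq_nonneg e) (mixedDisc2_nonneg hA hP hP)) hpos.le
    apply le_of_mul_le_mul_left _ he
    nlinarith
  have hp : 0 < 2 * mixedDisc2 A A' P * mixedDisc2 A B B := by positivity
  set p := 2 * mixedDisc2 A A' P * mixedDisc2 A B B
  set q := mixedDisc2 A P B ^ 2 with hq
  have hq0 : 0 ≤ q := sq_nonneg _
  have := key (p / (2 * (q + 1))) (by positivity)
  rw [div_mul_eq_mul_div, le_div_iff₀ (by positivity)] at this
  nlinarith
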